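/- arXiv:1009.4297 — 4 statements merged into one kernel-verified Lean document; each statement's English description precedes it below -/
import Mathlib

section
/- For every even positive integer N, all couplings J₁, J₂ ∈ ℝ, every spin configuration S on T_N, and every site r ∈ T_N whose two coordinates are both even or both odd, the plaquette-flip map preserves the energy: H_N(φ_r(S)) = H_N(S). -/
open scoped BigOperators

/-- The `N × N` torus `(ℤ/Nℤ)²`. -/
abbrev Torus (N : ℕ) := ZMod N × ZMod N

/-- A spin configuration assigns a unit vector of `ℝ²` to each site. -/
def IsConfig {N : ℕ} (S : Torus N → ℝ × ℝ) : Prop :=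
  ∀ r, (S r).1 ^ 2 + (S r).2 ^ 2 = 1

/-- The plaquette-orbital Hamiltonian on the torus. -/
noncomputable def ham (N : ℕ) [NeZero N] (J₁ J₂ : ℝ) (S : Torus N → ℝ × ℝ) : ℝ :=
  - J₁ * ((∑ r : Torus N, if Even r.1.val then (S r).1 * (S (r + (1, 0))).1 else 0)
        + (∑ r : Torus N, if Even r.2.val then (S r).1 * (S (r + (0, 1))).1 else 0))
  - J₂ * ((∑ r : Torus N, if ¬ Even r.1.val then (S r).2 * (S (r + (1, 0))).2 else 0)
        + (∑ r : Torus N, if ¬ Even r.2.val then (S r).2 * (S (r + (0, 1))).2 else 0))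

/-- The plaquette flip `φ_r`: for `r` with both coordinates even it negates the
`x`-components at the four sites `r, r+e₁, r+e₂, r+e₁+e₂`; for `r` with both
coordinates odd it negates the `z`-components there; otherwise it does nothing. -/
def plaqFlip (N : ℕ) [NeZero N] (r : Torus N) (S : Torus N → ℝ × ℝ) :
    Torus N → ℝ × ℝ := fun u =>
  if u = r ∨ u = r + (1, 0) ∨ u = r + (0, 1) ∨ u = r + (1, 1) then
    if Even r.1.val ∧ Even r.2.val then (-(S u).1, (S u).2)
    else if ¬ Even r.1.val ∧ ¬ Even r.2.val then ((S u).1, -(S u).2)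
    else S u
  else S u

theorem ZMod.even_val_add_one {N : ℕ} [NeZero N] (hN : Even N) (a : ZMod N) :
    Even (a + 1).val ↔ ¬ Even a.val := by
  have h1 : N ≠ 1 := by rintro rfl; simp at hN
  rw [ZMod.val_add, ZMod.val_one'' h1, Even.mod_even_iff hN, Nat.even_add_one]

/-- On a cycle of even length, the two endpoints of an edge starting at `a` lie both inside or
both outside `{b, b + 1}` when `a` and `b` have the same parity. -/
theorem ZMod.add_one_mem_pair_iff {N : ℕ} [NeZero N] (hN : Even N) {a b : ZMod N}
    (h : Even a.val ↔ Even b.val) :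
    (a + 1 = b ∨ a + 1 = b + 1) ↔ (a = b ∨ a = b + 1) := by
  have h₁ : a + 1 ≠ b := by
    rintro rfl
    rw [ZMod.even_val_add_one hN] at h
    tauto
  have h₂ : a ≠ b + 1 := by
    rintro rfl
    rw [ZMod.even_val_add_one hN] at h
    tauto
  simp [h₁, h₂]

theorem mem_plaquette_iff {N : ℕ} (r u : Torus N) :
    (u = r ∨ u = r + (1, 0) ∨ u = r + (0, 1) ∨ u = r + (1, 1)) ↔
      (u.1 = r.1 ∨ u.1 = r.1 + 1) ∧ (u.2 = r.2 ∨ u.2 = r.2 + 1) := by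
  simp only [Prod.ext_iff, Prod.fst_add, Prod.snd_add, add_zero]
  tauto

theorem mem_plaquette_add_fst_iff {N : ℕ} [NeZero N] (hN : Even N) {r u : Torus N}
    (h : Even u.1.val ↔ Even r.1.val) :
    (u + (1, 0) = r ∨ u + (1, 0) = r + (1, 0) ∨ u + (1, 0) = r + (0, 1) ∨
        u + (1, 0) = r + (1, 1)) ↔
      (u = r ∨ u = r + (1, 0) ∨ u = r + (0, 1) ∨ u = r + (1, 1)) := by
  rw [mem_plaquette_iff, mem_plaquette_iff, Prod.fst_add, Prod.snd_add, add_zero,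
    ZMod.add_one_mem_pair_iff hN h]

theorem mem_plaquette_add_snd_iff {N : ℕ} [NeZero N] (hN : Even N) {r u : Torus N}
    (h : Even u.2.val ↔ Even r.2.val) :
    (u + (0, 1) = r ∨ u + (0, 1) = r + (1, 0) ∨ u + (0, 1) = r + (0, 1) ∨
        u + (0, 1) = r + (1, 1)) ↔
      (u = r ∨ u = r + (1, 0) ∨ u = r + (0, 1) ∨ u = r + (1, 1)) := by
  rw [mem_plaquette_iff, mem_plaquette_iff, Prod.fst_add, Prod.snd_add, add_zero,
    ZMod.add_one_mem_pair_iff hN h]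

theorem ham_plaqFlip_invariant (N : ℕ) [NeZero N] (hN : Even N) (J₁ J₂ : ℝ)
    (S : Torus N → ℝ × ℝ) (hS : IsConfig S) (r : Torus N)
    (hr : (Even r.1.val ∧ Even r.2.val) ∨ (¬ Even r.1.val ∧ ¬ Even r.2.val)) :
    ham N J₁ J₂ (plaqFlip N r S) = ham N J₁ J₂ S := by
  unfold ham
  congr 3 <;> refine Finset.sum_congr rfl fun u _ ↦ ?_ <;>
    split_ifs with hu <;> try rfl
  all_goals
    rcases hr with ⟨h₁, h₂⟩ | ⟨h₁, h₂⟩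
    all_goals
      simp only [plaqFlip, h₁, h₂, and_self, not_true_eq_false, not_false_eq_true, if_true,
        if_false]
      first
      | simp only [mem_plaquette_add_fst_iff (r := r) (u := u) hN (by tauto)]
        split_ifs <;> simp
      | simp only [mem_plaquette_add_snd_iff (r := r) (u := u) hN (by tauto)]
        split_ifs <;> simp
      | split_ifs <;> rfl
end

section
/- For all k = (k₁,k₂) ∈ [−π,π]² and all θ ∈ ℝ, the determinant of the 4×4 matrix M(k,θ) admits the factorization det M(k,θ) = (1 − ρ²)(A − ρ² C), where ρ = −cos(2θ), A := (1/16)(|a₋|²+|b₋|²)(|a₊|²+|b₋|²)(|a₋|²+|b₊|²)(|a₊|²+|b₊|²) and C := (1/16)(|a₋|²|a₊|² − |b₋|²|b₊|²)². -/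
/-- `a₋ = 1 − e^{−ik}` (argument `k = k₁` or `k₂`). -/
noncomputable def am (k : ℝ) : ℂ := 1 - Complex.exp (-Complex.I * k)

/-- `a₊ = 1 + e^{−ik}`. -/
noncomputable def ap (k : ℝ) : ℂ := 1 + Complex.exp (-Complex.I * k)

/-- The 4×4 matrix `M(k,θ)` of the spin-wave quadratic form, with
`ρ = −cos(2θ)`. -/
noncomputable def Mmat (k₁ k₂ θ : ℝ) : Matrix (Fin 4) (Fin 4) ℂ :=
  let ρ : ℂ := ((-Real.cos (2 * θ) : ℝ) : ℂ)
  let aMv := am k₁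
  let aPv := ap k₁
  let bMv := am k₂
  let bPv := ap k₂
  (1 / 2 : ℂ) •
    !![((Complex.normSq aMv + Complex.normSq bMv : ℝ) : ℂ), ρ * aMv * (starRingEnd ℂ) aPv,
         ρ * bMv * (starRingEnd ℂ) bPv, 0;
       ρ * (starRingEnd ℂ) aMv * aPv, ((Complex.normSq aPv + Complex.normSq bMv : ℝ) : ℂ), 0,
         ρ * bMv * (starRingEnd ℂ) bPv;
       ρ * (starRingEnd ℂ) bMv * bPv, 0, ((Complex.normSq aMv + Complex.normSq bPv : ℝ) : ℂ),
         ρ * aMv * (starRingEnd ℂ) aPv;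
       0, ρ * (starRingEnd ℂ) bMv * bPv, ρ * (starRingEnd ℂ) aMv * aPv,
         ((Complex.normSq aPv + Complex.normSq bPv : ℝ) : ℂ)]

/-- The quantity `A = (1/16)(|a₋|²+|b₋|²)(|a₊|²+|b₋|²)(|a₋|²+|b₊|²)(|a₊|²+|b₊|²)`. -/
noncomputable def Adef (k₁ k₂ : ℝ) : ℝ :=
  (1 / 16) * (Complex.normSq (am k₁) + Complex.normSq (am k₂)) *
    (Complex.normSq (ap k₁) + Complex.normSq (am k₂)) *
    (Complex.normSq (am k₁) + Complex.normSq (ap k₂)) *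
    (Complex.normSq (ap k₁) + Complex.normSq (ap k₂))

/-- The quantity `C = (1/16)(|a₋|²|a₊|² − |b₋|²|b₊|²)²`. -/
noncomputable def Cdef (k₁ k₂ : ℝ) : ℝ :=
  (1 / 16) * (Complex.normSq (am k₁) * Complex.normSq (ap k₁) -
      Complex.normSq (am k₂) * Complex.normSq (ap k₂)) ^ 2

/-- Determinant of a `4 × 4` matrix supported on the diagonal and on the edges of the square. -/
theorem det_square_hopping (r d₁ d₂ d₃ d₄ u u' v v' : ℂ) :
    ((1 / 2 : ℂ) • !![d₁, r * u, r * v, 0; r * u', d₂, 0, r * v;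
      r * v', 0, d₃, r * u; 0, r * v', r * u', d₄]).det =
      (1 / 16) * (d₁ * d₂ * d₃ * d₄ -
        r ^ 2 * (u * u' * (d₁ * d₂ + d₃ * d₄) + v * v' * (d₁ * d₃ + d₂ * d₄)) +
        r ^ 4 * (u * u' - v * v') ^ 2) := by
  rw [Matrix.det_smul, Matrix.det_succ_row_zero]
  simp [Fin.sum_univ_succ, Matrix.det_fin_three, Fin.succAbove]
  ring

theorem normSq_am_add_normSq_ap (k : ℝ) :
    Complex.normSq (am k) + Complex.normSq (ap k) = 4 := by
  have h : Complex.normSq (Complex.exp (-Complex.I * k)) = 1 := by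
    rw [Complex.normSq_eq_norm_sq, Complex.norm_exp]
    simp
  rw [am, ap, Complex.normSq_sub, Complex.normSq_add, h]
  simp
  ring

/-- Factorization of the determinant:
`det M(k,θ) = (1 − ρ²)(A − ρ²C)` with `ρ = −cos(2θ)`. -/
theorem det_Mmat_factorization (k₁ k₂ θ : ℝ) (h₁ : k₁ ∈ Set.Icc (-Real.pi) Real.pi)
    (h₂ : k₂ ∈ Set.Icc (-Real.pi) Real.pi) :
    (Mmat k₁ k₂ θ).det =
      (((1 - (-Real.cos (2 * θ)) ^ 2) *
          (Adef k₁ k₂ - (-Real.cos (2 * θ)) ^ 2 * Cdef k₁ k₂) : ℝ) : ℂ) := by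
  have hu (z w : ℂ) : z * (starRingEnd ℂ) w * ((starRingEnd ℂ) z * w) =
      (Complex.normSq z : ℂ) * Complex.normSq w := by
    rw [← Complex.mul_conj, ← Complex.mul_conj]
    ring
  have hx : Complex.normSq (ap k₁) = 4 - Complex.normSq (am k₁) := by
    linarith [normSq_am_add_normSq_ap k₁]
  have hy : Complex.normSq (ap k₂) = 4 - Complex.normSq (am k₂) := by
    linarith [normSq_am_add_normSq_ap k₂]
  simp only [Mmat, mul_assoc]
  rw [det_square_hopping, hu, hu, Adef, Cdef, hx, hy]
  push_cast
  ring
end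

section
/- For all k = (k₁,k₂) ∈ [−π,π]² and all θ ∈ ℝ, det M(k,θ) is a real number and satisfies sin²(2θ) · sin²(k₁) · sin²(k₂) ≤ det M(k,θ) ≤ 16 · sin²(2θ). -/
theorem am_eq (k : ℝ) : am k = (1 - Real.cos k : ℝ) + (Real.sin k : ℝ) * Complex.I := by
  rw [am, show -Complex.I * (k : ℂ) = ((-k : ℝ) : ℂ) * Complex.I by push_cast; ring,
    Complex.exp_mul_I, ← Complex.ofReal_cos, ← Complex.ofReal_sin, Real.cos_neg, Real.sin_neg]
  push_cast
  ring

theorem ap_eq (k : ℝ) : ap k = (1 + Real.cos k : ℝ) + (-Real.sin k : ℝ) * Complex.I := by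
  rw [ap, show -Complex.I * (k : ℂ) = ((-k : ℝ) : ℂ) * Complex.I by push_cast; ring,
    Complex.exp_mul_I, ← Complex.ofReal_cos, ← Complex.ofReal_sin, Real.cos_neg, Real.sin_neg]
  push_cast
  ring

theorem normSq_am (k : ℝ) : Complex.normSq (am k) = 2 - 2 * Real.cos k := by
  rw [am_eq, Complex.normSq_add_mul_I]
  linear_combination Real.sin_sq_add_cos_sq k

theorem normSq_ap (k : ℝ) : Complex.normSq (ap k) = 2 + 2 * Real.cos k := by
  rw [ap_eq, Complex.normSq_add_mul_I]
  linear_combination Real.sin_sq_add_cos_sq k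

theorem am_mul_conj_ap (k : ℝ) :
    am k * (starRingEnd ℂ) (ap k) = 2 * Complex.I * (Real.sin k : ℝ) := by
  have h : ((Real.sin k : ℝ) : ℂ) ^ 2 + ((Real.cos k : ℝ) : ℂ) ^ 2 = 1 :=
    mod_cast Real.sin_sq_add_cos_sq k
  rw [am_eq, ap_eq]
  simp only [map_add, map_mul, Complex.conj_ofReal, Complex.conj_I]
  push_cast at h ⊢
  linear_combination (Complex.sin k) ^ 2 * Complex.I_sq - h

theorem conj_am_mul_ap (k : ℝ) :
    (starRingEnd ℂ) (am k) * ap k = -(2 * Complex.I * (Real.sin k : ℝ)) := by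
  have h := congrArg (starRingEnd ℂ) (am_mul_conj_ap k)
  simp only [map_mul, Complex.conj_conj, Complex.conj_ofReal, Complex.conj_I, map_ofNat] at h
  rw [h]
  ring

theorem Mmat_eq (k₁ k₂ θ : ℝ) :
    Mmat k₁ k₂ θ =
      let x : ℂ := -Real.cos (2 * θ) * Complex.I * Real.sin k₁
      let y : ℂ := -Real.cos (2 * θ) * Complex.I * Real.sin k₂
      let c₁ : ℂ := Real.cos k₁
      let c₂ : ℂ := Real.cos k₂
      !![2 - c₁ - c₂, x, y, 0;
         -x, 2 + c₁ - c₂, 0, y;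
         -y, 0, 2 - c₁ + c₂, x;
         0, -y, -x, 2 + c₁ + c₂] := by
  simp only [Mmat, mul_assoc, am_mul_conj_ap, conj_am_mul_ap, normSq_am, normSq_ap]
  ext i j
  fin_cases i <;> fin_cases j <;> simp <;> ring

theorem det_Mmat (k₁ k₂ θ : ℝ) :
    (Mmat k₁ k₂ θ).det =
      ((8 * Real.sin (2 * θ) ^ 2 * (Real.sin k₁ ^ 2 + Real.sin k₂ ^ 2)
        + (Real.sin (2 * θ) ^ 2) ^ 2 * (Real.sin k₁ ^ 2 - Real.sin k₂ ^ 2) ^ 2 : ℝ) : ℂ) := by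
  have det_eq (c₁ c₂ x y : ℂ) :
      (!![2 - c₁ - c₂, x, y, 0;
         -x, 2 + c₁ - c₂, 0, y;
         -y, 0, 2 - c₁ + c₂, x;
         0, -y, -x, 2 + c₁ + c₂]).det =
      16 - 8 * ((c₁ ^ 2 - x ^ 2) + (c₂ ^ 2 - y ^ 2)) + ((c₁ ^ 2 - x ^ 2) - (c₂ ^ 2 - y ^ 2)) ^ 2 := by
    simp [Matrix.det_succ_row_zero, Fin.sum_univ_succ, Fin.succAbove]
    ring
  have radius_sq (k : ℝ) :
      ((Real.cos k : ℝ) : ℂ) ^ 2 - (-(Real.cos (2 * θ) : ℝ) * Complex.I * (Real.sin k : ℝ)) ^ 2 =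
        ((1 - Real.sin (2 * θ) ^ 2 * Real.sin k ^ 2 : ℝ) : ℂ) := by
    rw [mul_pow, mul_pow, Complex.I_sq, neg_sq, ← Complex.ofReal_pow, ← Complex.ofReal_pow,
      Real.cos_sq', Real.cos_sq']
    push_cast
    ring
  rw [Mmat_eq, det_eq, radius_sq, radius_sq]
  push_cast
  ring

/-- The determinant of `M(k,θ)` is real and satisfies
`sin²(2θ) sin²(k₁) sin²(k₂) ≤ det M(k,θ) ≤ 16 sin²(2θ)`. -/
theorem det_Mmat_bounds (k₁ k₂ θ : ℝ) (h₁ : k₁ ∈ Set.Icc (-Real.pi) Real.pi)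
    (h₂ : k₂ ∈ Set.Icc (-Real.pi) Real.pi) :
    ((Mmat k₁ k₂ θ).det).im = 0 ∧
    Real.sin (2 * θ) ^ 2 * Real.sin k₁ ^ 2 * Real.sin k₂ ^ 2 ≤ ((Mmat k₁ k₂ θ).det).re ∧
    ((Mmat k₁ k₂ θ).det).re ≤ 16 * Real.sin (2 * θ) ^ 2 := by
  have hs := sq_nonneg (Real.sin (2 * θ))
  have hs1 := Real.sin_sq_le_one (2 * θ)
  have hu := sq_nonneg (Real.sin k₁)
  have hu1 := Real.sin_sq_le_one k₁
  have hv := sq_nonneg (Real.sin k₂)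
  have hv1 := Real.sin_sq_le_one k₂
  rw [det_Mmat, Complex.ofReal_im, Complex.ofReal_re]
  generalize Real.sin (2 * θ) ^ 2 = s at *
  generalize Real.sin k₁ ^ 2 = u at *
  generalize Real.sin k₂ ^ 2 = v at *
  refine ⟨rfl, ?_, ?_⟩
  · have huv : u * v ≤ 8 * (u + v) := by nlinarith
    nlinarith [mul_le_mul_of_nonneg_left huv hs, mul_nonneg (sq_nonneg s) (sq_nonneg (u - v))]
  · have hd : (u - v) ^ 2 ≤ 8 * (2 - u - v) := by
      nlinarith [mul_nonneg hu (sub_nonneg.2 hu1), mul_nonneg hv (sub_nonneg.2 hv1),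
        mul_nonneg hu hv]
    have hsd : s * (u - v) ^ 2 ≤ 8 * (2 - u - v) :=
      (mul_le_of_le_one_left (sq_nonneg _) hs1).trans hd
    nlinarith [mul_le_mul_of_nonneg_left hsd hs]
end

section
/- Suppose J₁ = J₂ = J. There exists a constant c ∈ (0,∞) such that for every even N, every θ ∈ ℝ, every Δ ∈ (0,1), and every family (ϑ_r)_{r∈T_N} with ϑ_r ∈ (−π, π], if the configuration S defined by S_r := (cos(θ + ϑ_r), sin(θ + ϑ_r)) satisfies |S_r − (cos θ, sin θ)| < Δ for all r ∈ T_N, then |H_N(S) + J N² − J G_{N,θ}(ϑ)| ≤ c J N² Δ³. -/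
open scoped BigOperators

/-- The spin-wave quadratic form
`G_{N,θ}(ϑ) = ½ Σ_{x-edges}(ϑ_r − ϑ_{r'})² sin²θ + ½ Σ_{z-edges}(ϑ_r − ϑ_{r'})² cos²θ`. -/
noncomputable def Gsw (N : ℕ) [NeZero N] (θ : ℝ) (ϑ : Torus N → ℝ) : ℝ :=
  (1 / 2) * ((∑ r : Torus N, if Even r.1.val then (ϑ r - ϑ (r + (1, 0))) ^ 2 else 0)
           + (∑ r : Torus N, if Even r.2.val then (ϑ r - ϑ (r + (0, 1))) ^ 2 else 0)) *
      Real.sin θ ^ 2 +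
  (1 / 2) * ((∑ r : Torus N, if ¬ Even r.1.val then (ϑ r - ϑ (r + (1, 0))) ^ 2 else 0)
           + (∑ r : Torus N, if ¬ Even r.2.val then (ϑ r - ϑ (r + (0, 1))) ^ 2 else 0)) *
      Real.cos θ ^ 2

/-- Euclidean distance on `ℝ²`. -/
noncomputable def edist2 (v w : ℝ × ℝ) : ℝ :=
  Real.sqrt ((v.1 - w.1) ^ 2 + (v.2 - w.2) ^ 2)

/-- On a cycle of even length, stepping by one flips the parity. -/
lemma ZMod.even_val_add_one_iff {N : ℕ} [NeZero N] (hN : Even N) (x : ZMod N) :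
    Even (x + 1).val ↔ ¬ Even x.val := by
  have hN1 : 1 < N := by
    have := NeZero.ne N
    obtain ⟨k, rfl⟩ := hN
    omega
  have : Fact (1 < N) := ⟨hN1⟩
  rw [ZMod.val_add, ZMod.val_one, hN.mod_even_iff, Nat.even_add_one]

section Matching

variable {G : Type*} [AddCommGroup G] [Fintype G]

/-- If translation by `e` flips `p`, the edges `{r, r + e}` with `p r` cover each vertex once. -/
lemma sum_ite_add_translate (p : G → Prop) [DecidablePred p] (e : G)
    (hp : ∀ r, p (r + e) ↔ ¬ p r) (g : G → ℝ) :
    ∑ r, (if p r then g r + g (r + e) else 0) = ∑ r, g r := by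
  have hshift : ∑ r, (if p r then g (r + e) else 0) = ∑ r, (if ¬ p r then g r else 0) := by
    rw [← Equiv.sum_comp (Equiv.addRight e) (fun r => if ¬ p r then g r else 0)]
    refine Finset.sum_congr rfl fun r _ => ?_
    simp [hp]
  calc ∑ r, (if p r then g r + g (r + e) else 0)
      = ∑ r, (if p r then g r else 0) + ∑ r, (if p r then g (r + e) else 0) := by
        rw [← Finset.sum_add_distrib]
        refine Finset.sum_congr rfl fun r _ => ?_
        split_ifs <;> simp
    _ = ∑ r, g r := by
        rw [hshift, ← Finset.sum_add_distrib]
        refine Finset.sum_congr rfl fun r _ => ?_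
        split_ifs <;> simp

/-- Comparison of the interaction energy along a perfect matching with a quadratic form. -/
lemma abs_sum_ite_mul_translate_sub_le (p : G → Prop) [DecidablePred p] (e : G)
    (hp : ∀ r, p (r + e) ↔ ¬ p r) (u v : G → ℝ) (t ε : ℝ) (hε : 0 ≤ ε)
    (huv : ∀ r s, |(u r - u s) ^ 2 - (v r - v s) ^ 2 * t| ≤ ε) :
    |∑ r, (if p r then u r * u (r + e) else 0) - 1 / 2 * ∑ r, u r ^ 2
        + 1 / 2 * (∑ r, if p r then (v r - v (r + e)) ^ 2 else 0) * t|
      ≤ Fintype.card G * ε := by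
  have key : ∑ r, (if p r then u r * u (r + e) else 0) - 1 / 2 * ∑ r, u r ^ 2
        + 1 / 2 * (∑ r, if p r then (v r - v (r + e)) ^ 2 else 0) * t
      = ∑ r, (if p r then
          -(1 / 2) * ((u r - u (r + e)) ^ 2 - (v r - v (r + e)) ^ 2 * t) else 0) := by
    rw [← sum_ite_add_translate p e hp (fun r => u r ^ 2), Finset.mul_sum, Finset.mul_sum,
      Finset.sum_mul, ← Finset.sum_sub_distrib, ← Finset.sum_add_distrib]
    refine Finset.sum_congr rfl fun r _ => ?_
    split_ifs <;> ring
  rw [key]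
  refine (Finset.abs_sum_le_sum_abs _ _).trans ?_
  refine (Finset.sum_le_card_nsmul _ _ ε fun r _ => ?_).trans_eq (by simp)
  split_ifs
  · rw [abs_mul]
    have := huv r (r + e)
    norm_num
    linarith
  · simpa using hε

end Matching

lemma Real.abs_sin_sub_self_le_two_mul_sq (x : ℝ) : |Real.sin x - x| ≤ 2 * x ^ 2 := by
  rcases le_total |x| 1 with h | h
  · have h1 := abs_le.1 (Real.sin_bound h)
    have h0 := abs_nonneg x
    have hx := sq_abs x
    have h3 : |x ^ 3| ≤ x ^ 2 := by
      rw [abs_pow, ← hx]; exact pow_le_pow_of_le_one h0 h (by norm_num)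
    have h4 : |x| ^ 4 ≤ x ^ 2 := by
      rw [← hx]; exact pow_le_pow_of_le_one h0 h (by norm_num)
    have h3' := abs_le.1 h3
    rw [abs_le]
    constructor <;> nlinarith [sq_nonneg x]
  · have h1 : |Real.sin x - x| ≤ 1 + |x| :=
      (abs_sub _ _).trans (by linarith [Real.abs_sin_le_one x])
    nlinarith [sq_abs x]

/-- Increments of `cos` near `θ`, to second order. -/
lemma Real.abs_sq_cos_add_sub_cos_add_sub_le {θ a b Δ : ℝ} (hΔ0 : 0 < Δ)
    (ha : |a| ≤ 2 * Δ) (hb : |b| ≤ 2 * Δ) :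
    |(Real.cos (θ + a) - Real.cos (θ + b)) ^ 2 - (a - b) ^ 2 * Real.sin θ ^ 2|
      ≤ 200 * Δ ^ 3 := by
  have ha2 : a ^ 2 ≤ 4 * Δ ^ 2 := by rw [← sq_abs]; nlinarith [abs_nonneg a]
  have hb2 : b ^ 2 ≤ 4 * Δ ^ 2 := by rw [← sq_abs]; nlinarith [abs_nonneg b]
  have hab : |a - b| ≤ 4 * Δ := (abs_sub _ _).trans (by linarith)
  have hlip : |Real.cos (θ + a) - Real.cos (θ + b)| ≤ 4 * Δ := by
    have h := Real.abs_cos_sub_cos_le (θ + a) (θ + b)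
    rw [add_sub_add_left_eq_sub] at h
    exact h.trans hab
  have hlin : |(a - b) * Real.sin θ| ≤ 4 * Δ := by
    rw [abs_mul]
    nlinarith [abs_nonneg (a - b), Real.abs_sin_le_one θ]
  have hC : |Real.cos a - Real.cos b| ≤ 4 * Δ ^ 2 := by
    rw [abs_le]
    constructor <;> linarith [Real.one_sub_sq_div_two_le_cos (x := a),
      Real.one_sub_sq_div_two_le_cos (x := b), Real.cos_le_one a, Real.cos_le_one b]
  have hS : |(Real.sin a - a) - (Real.sin b - b)| ≤ 16 * Δ ^ 2 :=
    (abs_sub _ _).trans (by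
      linarith [Real.abs_sin_sub_self_le_two_mul_sq a, Real.abs_sin_sub_self_le_two_mul_sq b])
  have hminus : |Real.cos (θ + a) - Real.cos (θ + b) + (a - b) * Real.sin θ| ≤ 20 * Δ ^ 2 := by
    have e : Real.cos (θ + a) - Real.cos (θ + b) + (a - b) * Real.sin θ
        = Real.cos θ * (Real.cos a - Real.cos b)
          - Real.sin θ * ((Real.sin a - a) - (Real.sin b - b)) := by
      rw [Real.cos_add, Real.cos_add]; ring
    rw [e]
    refine (abs_sub _ _).trans ?_
    rw [abs_mul, abs_mul]
    have h1 := mul_le_mul (Real.abs_cos_le_one θ) hC (abs_nonneg _) zero_le_one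
    have h2 := mul_le_mul (Real.abs_sin_le_one θ) hS (abs_nonneg _) zero_le_one
    linarith
  have hplus : |Real.cos (θ + a) - Real.cos (θ + b) - (a - b) * Real.sin θ| ≤ 8 * Δ :=
    (abs_sub _ _).trans (by linarith)
  have e : (Real.cos (θ + a) - Real.cos (θ + b)) ^ 2 - (a - b) ^ 2 * Real.sin θ ^ 2
      = (Real.cos (θ + a) - Real.cos (θ + b) + (a - b) * Real.sin θ)
        * (Real.cos (θ + a) - Real.cos (θ + b) - (a - b) * Real.sin θ) := by ring
  rw [e, abs_mul]
  have h := mul_le_mul hminus hplus (abs_nonneg _) (by positivity)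
  nlinarith [pow_pos hΔ0 3]

/-- Increments of `sin` near `θ`, to second order. -/
lemma Real.abs_sq_sin_add_sub_sin_add_sub_le {θ a b Δ : ℝ} (hΔ0 : 0 < Δ)
    (ha : |a| ≤ 2 * Δ) (hb : |b| ≤ 2 * Δ) :
    |(Real.sin (θ + a) - Real.sin (θ + b)) ^ 2 - (a - b) ^ 2 * Real.cos θ ^ 2|
      ≤ 200 * Δ ^ 3 := by
  have h := Real.abs_sq_cos_add_sub_cos_add_sub_le (θ := θ - Real.pi / 2) hΔ0 ha hb
  have e (x : ℝ) : Real.cos (θ - Real.pi / 2 + x) = Real.sin (θ + x) := by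
    rw [← Real.cos_sub_pi_div_two]; ring_nf
  rwa [e, e, Real.sin_sub_pi_div_two, neg_sq] at h

/-- The angle of a planar spin is controlled by its chordal distance to the reference spin. -/
lemma abs_le_of_edist2_lt {θ φ Δ : ℝ} (hφ : φ ∈ Set.Ioc (-Real.pi) Real.pi)
    (h : edist2 (Real.cos (θ + φ), Real.sin (θ + φ)) (Real.cos θ, Real.sin θ) < Δ) :
    |φ| ≤ 2 * Δ := by
  have hΔ : 0 < Δ := (Real.sqrt_nonneg _).trans_lt h
  have hsq : 2 - 2 * Real.cos φ < Δ ^ 2 := by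
    have h' := (Real.sqrt_lt' hΔ).1 h
    have e : Real.cos φ = Real.cos (θ + φ) * Real.cos θ + Real.sin (θ + φ) * Real.sin θ := by
      rw [← Real.cos_sub, add_sub_cancel_left]
    dsimp only at h'
    nlinarith [Real.sin_sq_add_cos_sq θ, Real.sin_sq_add_cos_sq (θ + φ)]
  have hcos := Real.cos_le_one_sub_mul_cos_sq (abs_le.2 ⟨hφ.1.le, hφ.2⟩)
  have hpi : 1 / 8 ≤ 2 / Real.pi ^ 2 := by
    rw [div_le_div_iff₀ (by norm_num) (by positivity)]
    nlinarith [Real.pi_pos, Real.pi_le_four]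
  refine abs_le_of_sq_le_sq ?_ (by positivity)
  nlinarith [mul_le_mul_of_nonneg_right hpi (sq_nonneg φ)]

/-- Gaussian (spin-wave) approximation of the Hamiltonian: there is a universal
constant `c` such that for spins `S_r = (cos(θ+ϑ_r), sin(θ+ϑ_r))` within Euclidean
distance `Δ` of `ê(θ) = (cos θ, sin θ)`,
`|H_N(S) + J·N² − J·G_{N,θ}(ϑ)| ≤ c J N² Δ³`. -/
theorem spin_wave_approximation :
    ∃ c : ℝ, 0 < c ∧
      ∀ (J : ℝ), 0 < J → ∀ (N : ℕ) [NeZero N], Even N →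
        ∀ (θ Δ : ℝ), Δ ∈ Set.Ioo (0 : ℝ) 1 →
          ∀ ϑ : Torus N → ℝ, (∀ r, ϑ r ∈ Set.Ioc (-Real.pi) Real.pi) →
            (∀ r : Torus N,
              edist2 (Real.cos (θ + ϑ r), Real.sin (θ + ϑ r)) (Real.cos θ, Real.sin θ) < Δ) →
            |ham N J J (fun r => (Real.cos (θ + ϑ r), Real.sin (θ + ϑ r)))
                + J * (N : ℝ) ^ 2 - J * Gsw N θ ϑ|
              ≤ c * J * (N : ℝ) ^ 2 * Δ ^ 3 := by
  refine ⟨800, by norm_num, fun J hJ N _ hN θ Δ hΔ ϑ hϑ hS => ?_⟩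
  have hb r : |ϑ r| ≤ 2 * Δ := abs_le_of_edist2_lt (hϑ r) (hS r)
  have hε : 0 ≤ 200 * Δ ^ 3 := by have := hΔ.1; positivity
  have h₁ (r : Torus N) : Even (r + (1, 0)).1.val ↔ ¬ Even r.1.val :=
    ZMod.even_val_add_one_iff hN r.1
  have h₂ (r : Torus N) : Even (r + (0, 1)).2.val ↔ ¬ Even r.2.val :=
    ZMod.even_val_add_one_iff hN r.2
  have hcos (r s : Torus N) := Real.abs_sq_cos_add_sub_cos_add_sub_le (θ := θ) hΔ.1 (hb r) (hb s)
  have hsin (r s : Torus N) := Real.abs_sq_sin_add_sub_sin_add_sub_le (θ := θ) hΔ.1 (hb r) (hb s)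
  have x₁ := abs_sum_ite_mul_translate_sub_le (fun r : Torus N => Even r.1.val) (1, 0) h₁
    (fun r => Real.cos (θ + ϑ r)) ϑ _ _ hε hcos
  have x₂ := abs_sum_ite_mul_translate_sub_le (fun r : Torus N => Even r.2.val) (0, 1) h₂
    (fun r => Real.cos (θ + ϑ r)) ϑ _ _ hε hcos
  have z₁ := abs_sum_ite_mul_translate_sub_le (fun r : Torus N => ¬ Even r.1.val) (1, 0)
    (fun r => not_congr (h₁ r)) (fun r => Real.sin (θ + ϑ r)) ϑ _ _ hε hsin
  have z₂ := abs_sum_ite_mul_translate_sub_le (fun r : Torus N => ¬ Even r.2.val) (0, 1)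
    (fun r => not_congr (h₂ r)) (fun r => Real.sin (θ + ϑ r)) ϑ _ _ hε hsin
  have hcard : (Fintype.card (Torus N) : ℝ) = (N : ℝ) ^ 2 := by
    simp [Torus, Fintype.card_prod, ZMod.card, sq]
  have htot : ∑ r : Torus N, Real.cos (θ + ϑ r) ^ 2 + ∑ r : Torus N, Real.sin (θ + ϑ r) ^ 2
      = (N : ℝ) ^ 2 := by
    rw [← Finset.sum_add_distrib, ← hcard]
    simp
  rw [hcard] at x₁ x₂ z₁ z₂
  have hsum := (abs_add_le _ _).trans (add_le_add
    ((abs_add_le _ _).trans (add_le_add x₁ x₂)) ((abs_add_le _ _).trans (add_le_add z₁ z₂)))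
  have hJsum := mul_le_mul_of_nonneg_left hsum hJ.le
  rw [← abs_of_pos hJ, ← abs_mul, ← abs_neg, abs_of_pos hJ] at hJsum
  refine (le_of_eq ?_).trans (hJsum.trans_eq (by ring))
  congr 1
  rw [← htot]
  unfold ham Gsw
  ring
end
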